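/- (Convexity of the nullcline) Let n ≥ 1 be an integer and let P : ℝ → ℝ be a function that is twice continuously differentiable on the open interval I = (0, n/(2n+1)) and satisfies, for every q ∈ I, q < P(q) < 1−q and J_n(q, P(q)) = 0. Then the second derivative of P is strictly positive at every point of I. -/

import Mathlib

noncomputable def phi (n : ℕ) (z : ℝ) : ℝ :=
  ∑ r ∈ Finset.range (n + 1), (n.choose r : ℝ) ^ 2 * z ^ r
/-- `psi n z = Σ_{r=0}^{n-1} C(n,r+1) C(n,r) z^(r+1)`. -/
noncomputable def psi (n : ℕ) (z : ℝ) : ℝ :=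
  ∑ r ∈ Finset.range n, (n.choose (r + 1) : ℝ) * (n.choose r : ℝ) * z ^ (r + 1)
/-- The indicator function `J n q p = (q/(1−q)) φ_n(z) − ψ_n(z)` with
`z = pq/((1−p)(1−q))`. -/
noncomputable def J (n : ℕ) (q p : ℝ) : ℝ :=
  (q / (1 - q)) * phi n (p * q / ((1 - p) * (1 - q))) -
    psi n (p * q / ((1 - p) * (1 - q)))

noncomputable def phiP (n : ℕ) : Polynomial ℝ :=
  ∑ r ∈ Finset.range (n + 1), Polynomial.monomial r ((n.choose r : ℝ) ^ 2)

noncomputable def psiP (n : ℕ) : Polynomial ℝ :=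
  ∑ r ∈ Finset.range n, Polynomial.monomial (r + 1) ((n.choose (r + 1) : ℝ) * (n.choose r : ℝ))

lemma phiP_eval (n : ℕ) (z : ℝ) : (phiP n).eval z = phi n z := by
  simp [phiP, phi, Polynomial.eval_finsetSum, Polynomial.eval_monomial]

lemma psiP_eval (n : ℕ) (z : ℝ) : (psiP n).eval z = psi n z := by
  simp [psiP, psi, Polynomial.eval_finsetSum, Polynomial.eval_monomial]

lemma phiP_coeff (n r : ℕ) : (phiP n).coeff r = (n.choose r : ℝ) ^ 2 := by
  simp only [phiP, Polynomial.finsetSum_coeff, Polynomial.coeff_monomial]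
  rw [Finset.sum_ite_eq']
  split_ifs with h
  · rfl
  · rw [Nat.choose_eq_zero_of_lt (by simpa using h)]; simp

lemma psiP_coeff_zero (n : ℕ) : (psiP n).coeff 0 = 0 := by
  simp [psiP, Polynomial.finsetSum_coeff, Polynomial.coeff_monomial]

lemma psiP_coeff (n r : ℕ) :
    (psiP n).coeff (r + 1) = (n.choose (r + 1) : ℝ) * (n.choose r : ℝ) := by
  simp only [psiP, Polynomial.finsetSum_coeff, Polynomial.coeff_monomial, add_left_inj]
  rw [Finset.sum_ite_eq']
  split_ifs with h
  · rfl
  · rw [Nat.choose_eq_zero_of_lt (n := n) (k := r + 1) (by simp at h; omega)]; simp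

lemma choose_rec (n r : ℕ) :
    ((r : ℝ) + 1) * (n.choose (r + 1) : ℝ) = ((n : ℝ) - r) * (n.choose r : ℝ) := by
  rcases le_or_gt r n with h | h
  · have := Nat.choose_succ_right_eq n r
    have h2 : ((n.choose (r + 1) * (r + 1) : ℕ) : ℝ) = ((n.choose r * (n - r) : ℕ) : ℝ) := by
      rw [this]
    push_cast [Nat.cast_sub h] at h2
    linarith
  · rw [Nat.choose_eq_zero_of_lt h, Nat.choose_eq_zero_of_lt (by omega : n < r + 1)]; simp

open Polynomial in
lemma phiP_ode (n : ℕ) :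
    X * derivative (phiP n) - X * (X * derivative (phiP n))
      = C ((n : ℝ) + 1) * psiP n - C (n : ℝ) * (X * phiP n) := by
  ext r
  rcases r with _ | r
  · simp [psiP_coeff_zero]
  · have h1 := choose_rec n r
    rcases r with _ | r
    · have h0 := psiP_coeff n 0
      simp only [coeff_sub, coeff_X_mul, coeff_C_mul, coeff_derivative, phiP_coeff,
        coeff_X_mul_zero, h0]
      simp
      ring
    · simp only [coeff_sub, coeff_X_mul, coeff_C_mul, coeff_derivative, phiP_coeff, psiP_coeff]
      push_cast at *
      set A := (n.choose (r+1) : ℝ)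
      set B := (n.choose (r+1+1) : ℝ)
      linear_combination (B - A) * h1

open Polynomial in
lemma psiP_ode (n : ℕ) :
    derivative (psiP n) - X * derivative (psiP n)
      = C (n : ℝ) * phiP n - C ((n : ℝ) + 1) * psiP n := by
  ext r
  rcases r with _ | r
  · simp [psiP_coeff_zero, coeff_derivative, phiP_coeff, psiP_coeff]
  · have h1 := choose_rec n r
    have h2 := choose_rec n (r + 1)
    simp only [coeff_sub, coeff_X_mul, coeff_C_mul, coeff_derivative, phiP_coeff, psiP_coeff]
    push_cast at *
    set A := (n.choose (r+1) : ℝ)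
    set B := (n.choose (r+1+1) : ℝ)
    set Z := (n.choose r : ℝ)
    linear_combination A * h2 - A * h1

lemma phi_ode (n : ℕ) (z : ℝ) :
    ∃ d, HasDerivAt (phi n) d z ∧ z * (1 - z) * d = (n + 1) * psi n z - n * z * phi n z := by
  refine ⟨(Polynomial.derivative (phiP n)).eval z, ?_, ?_⟩
  · have := (phiP n).hasDerivAt z
    rwa [show (fun x => (phiP n).eval x) = phi n from funext (phiP_eval n)] at this
  · have := congrArg (Polynomial.eval z) (phiP_ode n)
    simp [phiP_eval, psiP_eval] at this
    linear_combination this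

lemma psi_ode (n : ℕ) (z : ℝ) :
    ∃ d, HasDerivAt (psi n) d z ∧ (1 - z) * d = n * phi n z - (n + 1) * psi n z := by
  refine ⟨(Polynomial.derivative (psiP n)).eval z, ?_, ?_⟩
  · have := (psiP n).hasDerivAt z
    rwa [show (fun x => (psiP n).eval x) = psi n from funext (psiP_eval n)] at this
  · have := congrArg (Polynomial.eval z) (psiP_ode n)
    simp [phiP_eval, psiP_eval] at this
    linear_combination this

lemma phi_pos (n : ℕ) {z : ℝ} (hz : 0 ≤ z) : 0 < phi n z := by
  unfold phi
  rw [Finset.sum_range_succ']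
  have : 0 ≤ ∑ k ∈ Finset.range n, (n.choose (k + 1) : ℝ) ^ 2 * z ^ (k + 1) :=
    Finset.sum_nonneg fun i _ => by positivity
  simp
  linarith

lemma psi_pos (n : ℕ) (hn : 1 ≤ n) {z : ℝ} (hz : 0 < z) : 0 < psi n z := by
  unfold psi
  apply Finset.sum_pos
  · intro i hi
    have hi' : i < n := by simpa using hi
    have h1 := Nat.choose_pos (n := n) (k := i + 1) (by omega)
    have h2 := Nat.choose_pos (n := n) (k := i) (by omega)
    positivity
  · simp; omega

/-- The ratio `a = psi/phi` and its Riccati equation. -/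
noncomputable def aa (n : ℕ) (z : ℝ) : ℝ := psi n z / phi n z

lemma aa_pos (n : ℕ) (hn : 1 ≤ n) {z : ℝ} (hz : 0 < z) : 0 < aa n z :=
  div_pos (psi_pos n hn hz) (phi_pos n hz.le)

lemma aa_deriv (n : ℕ) {z : ℝ} (hz : 0 < z) (hz1 : z < 1) :
    HasDerivAt (aa n) ((n * z - z * aa n z - (n + 1) * aa n z ^ 2) / (z * (1 - z))) z := by
  obtain ⟨d1, hd1, e1⟩ := phi_ode n z
  obtain ⟨d2, hd2, e2⟩ := psi_ode n z
  have hp := phi_pos n hz.le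
  have h := hd2.div hd1 hp.ne'
  have hw : 1 - z ≠ 0 := by linarith
  refine h.congr_deriv ?_
  unfold aa
  have e1' : d1 = ((n + 1) * psi n z - n * z * phi n z) / (z * (1 - z)) := by
    rw [← e1]; field_simp
  have e2' : d2 = (n * phi n z - (n + 1) * psi n z) / (1 - z) := by
    rw [← e2]; field_simp
  rw [e1', e2']
  field_simp
  ring

lemma barrier (f f' : ℝ → ℝ) (hf : ∀ x ∈ Set.Ioo (0:ℝ) 1, HasDerivAt f (f' x) x)
    (h0 : ∀ x ∈ Set.Ioo (0:ℝ) 1, f x = 0 → 0 < f' x)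
    (hi : ∀ᶠ x in nhdsWithin (0:ℝ) (Set.Ioi 0), 0 < f x) :
    ∀ x ∈ Set.Ioo (0:ℝ) 1, 0 < f x := by
  intro x0 hx0
  by_contra hneg
  push Not at hneg
  obtain ⟨d, hd, hdp⟩ := (mem_nhdsGT_iff_exists_Ioo_subset).1 hi
  have hd : 0 < d := hd
  set δ := min d x0 / 2 with hδ
  have hmin : 0 < min d x0 := lt_min hd hx0.1
  have hδ0 : 0 < δ := by positivity
  have hδd : δ < d := by have := min_le_left d x0; linarith
  have hδx : δ < x0 := by have := min_le_right d x0; linarith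
  have hcont : ContinuousOn f (Set.Icc δ x0) := fun x hx =>
    (hf x ⟨lt_of_lt_of_le hδ0 hx.1, lt_of_le_of_lt hx.2 hx0.2⟩).continuousAt.continuousWithinAt
  set K := Set.Icc δ x0 ∩ f ⁻¹' Set.Iic 0 with hK
  have hKc : IsClosed K := hcont.preimage_isClosed_of_isClosed isClosed_Icc isClosed_Iic
  have hKcomp : IsCompact K := isCompact_Icc.of_isClosed_subset hKc Set.inter_subset_left
  have hKne : K.Nonempty := ⟨x0, ⟨⟨hδx.le, le_rfl⟩, hneg⟩⟩
  obtain ⟨x1, hx1, hleast⟩ := hKcomp.exists_isLeast hKne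
  have hx1f : f x1 ≤ 0 := hx1.2
  have hfδ : 0 < f δ := hdp ⟨hδ0, hδd⟩
  have hne : δ ≠ x1 := by rintro h; rw [← h] at hx1f; linarith
  have hlt : δ < x1 := lt_of_le_of_ne hx1.1.1 hne
  have hx1m : x1 ∈ Set.Ioo (0:ℝ) 1 := ⟨by linarith, lt_of_le_of_lt hx1.1.2 hx0.2⟩
  have hleft : ∀ y ∈ Set.Ioo δ x1, 0 < f y := by
    intro y hy
    by_contra hc
    push Not at hc
    have : y ∈ K := ⟨⟨hy.1.le, by linarith [hy.2, hx1.1.2]⟩, hc⟩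
    have := hleast this
    linarith [hy.2]
  have hev : ∀ᶠ y in nhdsWithin x1 (Set.Iio x1), 0 < f y := by
    filter_upwards [Ioo_mem_nhdsLT hlt] with y hy using hleft y hy
  have hge : 0 ≤ f x1 := by
    have ht : Filter.Tendsto f (nhdsWithin x1 (Set.Iio x1)) (nhds (f x1)) :=
      (hf x1 hx1m).continuousAt.tendsto.mono_left nhdsWithin_le_nhds
    exact ge_of_tendsto ht (hev.mono fun y hy => hy.le)
  have hz : f x1 = 0 := le_antisymm hx1f hge
  have hpos := h0 x1 hx1m hz
  have hs := (hasDerivAt_iff_tendsto_slope.1 (hf x1 hx1m))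
  have hs2 : Filter.Tendsto (slope f x1) (nhdsWithin x1 (Set.Iio x1)) (nhds (f' x1)) :=
    hs.mono_left (nhdsWithin_mono _ (fun y hy => ne_of_lt hy))
  have hs3 := hs2.eventually (lt_mem_nhds hpos)
  have hs4 : ∀ᶠ y in nhdsWithin x1 (Set.Iio x1), y < x1 := self_mem_nhdsWithin
  obtain ⟨y, ⟨h1, h2⟩, h3⟩ := ((hev.and hs3).and hs4).exists
  rw [slope_def_field, hz, sub_zero] at h2
  have : f y / (y - x1) < 0 := div_neg_of_pos_of_neg h1 (by linarith)
  linarith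
lemma Q_neg (e T : ℝ) (he : 0 < e) (hT : 0 < T) (h1 : 4 * T ≤ 1 - 4 * e) :
    (1+e)^6*(3*e-1)+(1+e)^3*(-3+37*e+19*e^2+3*e^3)*T+(1+e)*(14+130*e+82*e^2+14*e^3)*T^2
    +(48+128*e+32*e^2)*T^3+32*T^4 < 0 := by
  obtain ⟨y, hy⟩ : ∃ y, y = 1 - 4 * e - 4 * T := ⟨_, rfl⟩
  have hT' : T = (1 - 4 * e - y) / 4 := by linarith
  have hy0 : 0 ≤ y := by linarith
  have hy1 : y ≤ 1 := by linarith
  have he4 : e < 1 / 4 := by linarith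
  have e2 : 0 < e^2 := by positivity
  have e2' : e^2 < 1/16 := by nlinarith
  have key : (1+e)^6*(3*e-1)+(1+e)^3*(-3+37*e+19*e^2+3*e^3)*T+(1+e)*(14+130*e+82*e^2+14*e^3)*T^2
    +(48+128*e+32*e^2)*T^3+32*T^4 =
    - (y * ((2 - y) * (3 - y) * (5 - y)) / 8) - e^2 * (15 - 7/4*y - 11/4*y^2 + 1/2*y^3)
    - e^4 * (35/8 + 7/2*y - 7/8*y^2 - e^2 * (15/4 - 3/4*y)) := by
    rw [hT']; ring
  rw [key]
  have a1 : 0 ≤ y * ((2 - y) * (3 - y) * (5 - y)) / 8 := by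
    have : 0 ≤ 2 - y := by linarith
    have : 0 ≤ 3 - y := by linarith
    have : 0 ≤ 5 - y := by linarith
    positivity
  have y2 : y^2 ≤ 1 := by nlinarith
  have a2 : 0 < e^2 * (15 - 7/4*y - 11/4*y^2 + 1/2*y^3) := by
    have : 0 ≤ y^3 := by positivity
    have : 0 < 15 - 7/4*y - 11/4*y^2 + 1/2*y^3 := by linarith
    positivity
  have a3 : 0 < e^4 * (35/8 + 7/2*y - 7/8*y^2 - e^2 * (15/4 - 3/4*y)) := by
    have : 0 < 35/8 + 7/2*y - 7/8*y^2 - e^2 * (15/4 - 3/4*y) := by nlinarith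
    positivity
  linarith

lemma Q_pos (e T : ℝ) (he : 0 < e) (hT : 0 < T)
    (hb : 0 < 4 * T^2 + (8 * e - 1 + e^2) * T - e * (1 - e^2) * (1 + e)) :
    0 < (1+e)^6*(3*e-1)+(1+e)^3*(-3+37*e+19*e^2+3*e^3)*T+(1+e)*(14+130*e+82*e^2+14*e^3)*T^2
    +(48+128*e+32*e^2)*T^3+32*T^4 := by
  rcases le_or_gt (1/3) e with h | h
  · have h1 : 0 ≤ 3*e-1 := by linarith
    have h2 : 0 < -3+37*e+19*e^2+3*e^3 := by
      have : 0 < 19*e^2+3*e^3 := by positivity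
      linarith
    positivity
  · obtain ⟨y, hy⟩ : ∃ y, y = 4 * T - (1 - 2*e)^2 := ⟨_, rfl⟩
    have hT' : T = ((1 - 2*e)^2 + y) / 4 := by linarith
    have e2 : e^2 < 1/9 := by nlinarith
    have hy0 : 0 < y := by
      by_contra hc
      push Not at hc
      have k1 : 4 * T^2 ≤ T * (1-2*e)^2 := by nlinarith
      have k2 : T * (4*e + 5*e^2) ≤ (1-2*e)^2/4 * (4*e+5*e^2) := by
        apply mul_le_mul_of_nonneg_right _ (by positivity)
        linarith
      have k3 : (1-2*e)^2/4 * (4*e+5*e^2) - e * (1 - e^2) * (1 + e) = - e^2 * (15/4 - 6 * e^2) := by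
        ring
      have k4 : 0 < e^2 * (15/4 - 6 * e^2) := by
        have : 0 < 15/4 - 6 * e^2 := by linarith
        positivity
      nlinarith
    have key : (1+e)^6*(3*e-1)+(1+e)^3*(-3+37*e+19*e^2+3*e^3)*T+(1+e)*(14+130*e+82*e^2+14*e^3)*T^2
      +(48+128*e+32*e^2)*T^3+32*T^4 =
      (405/8*e^4+567/4*e^6+81*e^8) + y*(15/4+117/4*e^2+171/2*e^4+255/4*e^6)
      + y^2*(31/8+71/4*e^2+151/8*e^4) + y^3*(5/4+5/2*e^2) + y^4/8 := by
      rw [hT']; ring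
    rw [key]
    positivity

lemma key_alg (e T g : ℝ) (he : 0 < e) (he1 : e < 1) (hT : 0 < T) (hg : 0 < g)
    (hc : (1 - e^2) * g^2 + 2 * e^2 * g * ((1 + e)^2 / 2 + T) = (1 - e^2) * (T^2 + 2 * T * e)) :
    g * ((1 + e)^2 * (1 - 6 * e + e^2) - 4 * (1 + e^2) * T)
      + (1 - e^2) * (4 * T^2 + (8 * e - 1 + e^2) * T - e * (1 - e^2) * (1 + e)) < 0 := by
  obtain ⟨al, hal⟩ : ∃ al, al = (1 + e)^2 * (1 - 6 * e + e^2) - 4 * (1 + e^2) * T := ⟨_, rfl⟩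
  obtain ⟨be, hbe⟩ : ∃ be, be = 4 * T^2 + (8 * e - 1 + e^2) * T - e * (1 - e^2) * (1 + e) := ⟨_, rfl⟩
  rw [← hal, ← hbe]
  obtain ⟨Q, hQ⟩ : ∃ Q, Q = (1+e)^6*(3*e-1)+(1+e)^3*(-3+37*e+19*e^2+3*e^3)*T+(1+e)*(14+130*e+82*e^2+14*e^3)*T^2
    +(48+128*e+32*e^2)*T^3+32*T^4 := ⟨_, rfl⟩
  have hw : 0 < 1 - e^2 := by nlinarith
  obtain ⟨L, hL⟩ : ∃ L, L = (1 + e)^2 / 2 + T := ⟨_, rfl⟩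
  rw [← hL] at hc
  have hLpos : 0 < L := by rw [hL]; positivity
  have hR : (1 - e^2)^2 * be^2 - 2 * e^2 * al * be * L - (T^2 + 2*T*e) * al^2
      = - e^2 * (1 - e^2) * Q := by
    rw [hal, hbe, hQ, hL]; ring
  have hfac : (g * al + (1 - e^2) * be) * ((1 - e^2) * (g * al - (1 - e^2) * be) + 2 * e^2 * al * L)
      = (1 - e^2) * (e^2 * (1 - e^2) * Q) := by
    linear_combination al^2 * hc - (1 - e^2) * hR
  by_contra hH
  push Not at hH
  rcases le_or_gt 0 al with ha | ha
  · -- 4T ≤ 1-4e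
    have h1 : 4 * T ≤ 1 - 4 * e := by
      by_contra h
      push Not at h
      have : al < (1 + e)^2 * (1 - 6 * e + e^2) - (1 + e^2) * (1 - 4 * e) := by
        have h2 : (1 + e^2) * (1 - 4*e) < (1 + e^2) * (4 * T) :=
          mul_lt_mul_of_pos_left h (by positivity)
        rw [hal]; linarith
      have h3 : (1 + e)^2 * (1 - 6 * e + e^2) - (1 + e^2) * (1 - 4 * e) = -e^2*(11 - e^2) := by ring
      have h4 : 0 < e^2 * (11 - e^2) := mul_pos (pow_pos he 2) (by linarith)
      linarith
    have he4 : e < 1/4 := by linarith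
    have hb : be < 0 := by
      have : be = T * (4 * T - (1 - 4*e)) + e * (T * (4 + e) - (1 - e^2) * (1 + e)) := by
        rw [hbe]; ring
      have h5 : T * (4 * T - (1 - 4*e)) ≤ 0 :=
        mul_nonpos_of_nonneg_of_nonpos hT.le (by linarith)
      have h6 : T * (4 + e) - (1 - e^2) * (1 + e) < 0 := by
        have : T * (4 + e) ≤ (1/4 - e) * (4 + e) :=
          mul_le_mul_of_nonneg_right (by linarith) (by linarith)
        have h7 : (1/4 - e) * (4 + e) - (1 - e^2) * (1 + e) = - e * (19/4 - e^2) := by ring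
        have h8 : 0 < e * (19/4 - e^2) := mul_pos he (by linarith)
        linarith
      have := mul_neg_of_pos_of_neg he h6
      linarith
    have hQn : Q < 0 := by rw [hQ]; exact Q_neg e T he hT h1
    have hl : 0 ≤ (1 - e^2) * (g * al - (1 - e^2) * be) + 2 * e^2 * al * L := by
      have : 0 ≤ g * al - (1 - e^2) * be := by
        have := mul_nonneg hg.le ha
        have := mul_neg_of_pos_of_neg hw hb
        linarith
      positivity
    have h7 := mul_nonneg hH hl
    rw [hfac] at h7
    have : (1 - e^2) * (e^2 * (1 - e^2) * Q) < 0 := by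
      have h9 : 0 < (1 - e^2) * (e^2 * (1 - e^2)) := by positivity
      have h10 := mul_neg_of_pos_of_neg h9 hQn
      linarith
    linarith
  · have hb : 0 < be := by
      have : g * al < 0 := mul_neg_of_pos_of_neg hg ha
      by_contra h
      push Not at h
      have := mul_nonpos_of_nonneg_of_nonpos hw.le h
      linarith
    have hQp : 0 < Q := by rw [hQ]; exact Q_pos e T he hT (hbe ▸ hb)
    have hl : (1 - e^2) * (g * al - (1 - e^2) * be) + 2 * e^2 * al * L ≤ 0 := by
      have h8 : g * al - (1 - e^2) * be ≤ 0 := by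
        have := mul_neg_of_pos_of_neg hg ha
        have := mul_pos hw hb
        linarith
      have h9 : 2 * e^2 * al * L ≤ 0 := by
        have := mul_neg_of_pos_of_neg (mul_pos (pow_pos he 2) hLpos) ha
        linarith
      have := mul_nonpos_of_nonneg_of_nonpos hw.le h8
      linarith
    have h7 := mul_nonpos_of_nonneg_of_nonpos hH hl
    rw [hfac] at h7
    have : 0 < (1 - e^2) * (e^2 * (1 - e^2) * Q) := by positivity
    linarith
lemma phi_expand (n : ℕ) (z : ℝ) : phi n z = 1 + (n:ℝ)^2 * z + ((n:ℝ)*(n-1)/2)^2 * z^2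
    + z^3 * ∑ r ∈ Finset.range (n + 1), (n.choose (r+3) : ℝ)^2 * z^r := by
  have h1 : phi n z = ∑ r ∈ Finset.range (n + 1 + 3), (n.choose r : ℝ) ^ 2 * z ^ r := by
    unfold phi
    apply Finset.sum_subset
    · intro i; simp; omega
    · intro i _ hi
      rw [Nat.choose_eq_zero_of_lt (by simpa using hi)]; simp
  rw [h1, Finset.sum_range_succ', Finset.sum_range_succ', Finset.sum_range_succ', Finset.mul_sum]
  have h2 : (n.choose 2 : ℝ) = n * (n - 1) / 2 := Nat.cast_choose_two ℝ n
  have h3 : ∀ i ∈ Finset.range (n+1), (n.choose (i + 1 + 1 + 1) : ℝ) ^ 2 * z ^ (i + 1 + 1 + 1)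
      = z ^ 3 * ((n.choose (i + 3) : ℝ) ^ 2 * z ^ i) := by
    intro i _; ring
  rw [Finset.sum_congr rfl h3]
  norm_num [h2]
  ring

lemma psi_expand (n : ℕ) (z : ℝ) : psi n z = n * z + n * ((n:ℝ)*(n-1)/2) * z^2
    + ((n:ℝ)*(n-1)/2) * ((n:ℝ)*(n-1)*(n-2)/6) * z^3
    + z^4 * ∑ r ∈ Finset.range n, (n.choose (r+4) : ℝ) * (n.choose (r+3) : ℝ) * z^r := by
  have h1 : psi n z = ∑ r ∈ Finset.range (n + 3),
      (n.choose (r+1) : ℝ) * (n.choose r : ℝ) * z ^ (r+1) := by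
    unfold psi
    apply Finset.sum_subset
    · intro i; simp; omega
    · intro i _ hi
      rw [Nat.choose_eq_zero_of_lt (n := n) (k := i+1) (by simp at hi; omega)]; simp
  rw [h1, Finset.sum_range_succ', Finset.sum_range_succ', Finset.sum_range_succ', Finset.mul_sum]
  have h2 : (n.choose 2 : ℝ) = n * (n - 1) / 2 := Nat.cast_choose_two ℝ n
  have h4 : (n.choose 3 : ℝ) = n * (n - 1) * (n - 2) / 6 := by
    have := choose_rec n 2
    push_cast at this
    rw [h2] at this
    norm_num at this
    linarith
  have h3 : ∀ i ∈ Finset.range n, (n.choose (i + 1 + 1 + 1 + 1) : ℝ) * (n.choose (i + 1 + 1 + 1) : ℝ)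
       * z ^ (i + 1 + 1 + 1 + 1)
      = z ^ 4 * ((n.choose (i + 4) : ℝ) * (n.choose (i + 3) : ℝ) * z ^ i) := by
    intro i _; ring
  rw [Finset.sum_congr rfl h3]
  norm_num [h2, h4]
  ring

lemma aa_expand (n : ℕ) : ∃ ρ : ℝ → ℝ, DifferentiableAt ℝ ρ 0 ∧ ∀ z, 0 ≤ z →
    aa n z = z * (n - (n:ℝ)^2*(n+1)/2 * z + (n:ℝ)^2*(n+1)*(2*(n+1)*n-1)/6 * z^2 + z^3 * ρ z) := by
  let s1 : ℝ → ℝ := fun z => ∑ r ∈ Finset.range (n + 1), (n.choose (r+3) : ℝ)^2 * z^r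
  let s2 : ℝ → ℝ := fun z => ∑ r ∈ Finset.range n, (n.choose (r+4) : ℝ) * (n.choose (r+3) : ℝ) * z^r
  have hs1 : Differentiable ℝ s1 := by fun_prop
  have hs2 : Differentiable ℝ s2 := by fun_prop
  have hphi : Differentiable ℝ (phi n) := by unfold phi; fun_prop
  refine ⟨fun z => (s2 z - ((n:ℝ)^2 * ((n:ℝ)^2*(n+1)*(2*(n+1)*n-1)/6)
      - ((n:ℝ)*(n-1)/2)^2 * ((n:ℝ)^2*(n+1)/2)
      + z * ((n:ℝ)*(n-1)/2)^2 * ((n:ℝ)^2*(n+1)*(2*(n+1)*n-1)/6)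
      + s1 z * (n - (n:ℝ)^2*(n+1)/2 * z + (n:ℝ)^2*(n+1)*(2*(n+1)*n-1)/6 * z^2))) / phi n z,
    ?_, ?_⟩
  · apply DifferentiableAt.div
    · fun_prop
    · exact hphi 0
    · exact (phi_pos n le_rfl).ne'
  · intro z hz
    have hp := phi_pos n hz
    unfold aa
    rw [div_eq_iff hp.ne']
    have e1 := phi_expand n z
    have e2 := psi_expand n z
    change _ = _ + z^3 * s1 z at e1
    change _ = _ + z^4 * s2 z at e2
    have : ∀ N : ℝ, z * (n - (n:ℝ)^2*(n+1)/2 * z + (n:ℝ)^2*(n+1)*(2*(n+1)*n-1)/6 * z^2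
        + z^3 * (N / phi n z)) * phi n z
        = z * (n - (n:ℝ)^2*(n+1)/2 * z + (n:ℝ)^2*(n+1)*(2*(n+1)*n-1)/6 * z^2) * phi n z
         + z^4 * N := by
      intro N; field_simp
    rw [this, e2, e1]
    ring

noncomputable def hh (n : ℕ) (x : ℝ) : ℝ := aa n (x^2) / x
noncomputable def DD (n : ℕ) (x : ℝ) : ℝ := 2*x*(n - (n+1) * hh n x ^ 2) - hh n x * (1 + x^2)
noncomputable def OO (n : ℕ) (x : ℝ) : ℝ :=
  2 * hh n x^2 * (x + hh n x) * (1 + x * hh n x) * DD n x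
    + (1 - hh n x^2) * (DD n x^2 - hh n x^2 * (1 - x^2)^2)

lemma hh_pos (n : ℕ) (hn : 1 ≤ n) {x : ℝ} (hx : 0 < x) : 0 < hh n x :=
  div_pos (aa_pos n hn (by positivity)) hx

lemma hh_deriv (n : ℕ) {x : ℝ} (hx : 0 < x) (hx1 : x < 1) :
    HasDerivAt (hh n) (DD n x / (x * (1 - x^2))) x := by
  have hz : 0 < x^2 := by positivity
  have hz1 : x^2 < 1 := by nlinarith
  have h1 := aa_deriv n hz hz1
  have h2 : HasDerivAt (fun x : ℝ => x^2) (2 * x) x := by simpa using hasDerivAt_pow 2 x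
  have h3 := (HasDerivAt.comp (h := fun x : ℝ => x^2) x h1 h2).div (hasDerivAt_id x) hx.ne'
  refine h3.congr_deriv ?_
  have hw : 1 - x^2 ≠ 0 := by linarith
  simp only [DD, hh, Function.comp, id]
  field_simp
  ring

lemma DD_deriv (n : ℕ) {x : ℝ} (hx : 0 < x) (hx1 : x < 1) :
    HasDerivAt (DD n) (2*(n - (n+1) * hh n x ^ 2)
      - 4 * (n+1) * x * hh n x * (DD n x / (x * (1 - x^2)))
      - (DD n x / (x * (1 - x^2))) * (1 + x^2) - 2 * x * hh n x) x := by
  have h1 := hh_deriv n hx hx1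
  have h2 : HasDerivAt (fun x : ℝ => x^2) (2 * x) x := by simpa using hasDerivAt_pow 2 x
  have h3 := (((hasDerivAt_id x).const_mul 2).mul
    (((h1.pow 2).const_mul ((n:ℝ)+1)).const_sub (n:ℝ))).sub (h1.mul (h2.const_add 1))
  refine h3.congr_deriv ?_
  simp
  ring

lemma OO_deriv (n : ℕ) {x h' D' : ℝ} (h1 : HasDerivAt (hh n) h' x) (h2 : HasDerivAt (DD n) D' x) :
    HasDerivAt (OO n) (
      (2 * hh n x^2 * (x + hh n x) * (1 + x * hh n x) + (1 - hh n x^2) * (2 * DD n x)) * D'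
      + (4 * hh n x * (x + hh n x) * (1 + x * hh n x) * DD n x
          + 2 * hh n x^2 * (1 + x * hh n x) * DD n x
          + 2 * hh n x^2 * (x + hh n x) * x * DD n x
          - 2 * hh n x * (DD n x^2 - hh n x^2 * (1 - x^2)^2)
          - (1 - hh n x^2) * (2 * hh n x * (1 - x^2)^2)) * h'
      + (2 * hh n x^2 * (1 + x * hh n x) * DD n x
          + 2 * hh n x^2 * (x + hh n x) * hh n x * DD n x
          + (1 - hh n x^2) * (hh n x^2 * (4 * x * (1 - x^2))))) x := by
  have hx2 : HasDerivAt (fun x : ℝ => x^2) (2 * x) x := by simpa using hasDerivAt_pow 2 x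
  have hid := hasDerivAt_id x
  have a1 := (((h1.pow 2).const_mul 2).mul (hid.add h1)).mul ((hid.mul h1).const_add 1)
  have a2 := a1.mul h2
  have a3 := ((h1.pow 2).const_sub 1).mul
    ((h2.pow 2).sub ((h1.pow 2).mul ((hx2.const_sub 1).pow 2)))
  have a4 := a2.add a3
  refine a4.congr_deriv ?_
  simp
  ring
lemma sq_tendsto : Filter.Tendsto (fun x : ℝ => x^2) (nhdsWithin 0 (Set.Ioi 0))
    (nhdsWithin 0 (Set.Ioi 0)) := by
  apply tendsto_nhdsWithin_of_tendsto_nhds_of_eventually_within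
  · have : Filter.Tendsto (fun x : ℝ => x^2) (nhds 0) (nhds (0^2)) := (continuous_pow 2).tendsto 0
    simp only [ne_eq, OfNat.ofNat_ne_zero, not_false_eq_true, zero_pow] at this
    exact this.mono_left nhdsWithin_le_nhds
  · filter_upwards [self_mem_nhdsWithin] with x hx
    have : (0:ℝ) < x := hx
    show (0:ℝ) < x^2
    positivity

lemma init (n : ℕ) (hn : 1 ≤ n) :
    ∀ᶠ x in nhdsWithin (0:ℝ) (Set.Ioi 0), 0 < 1 - hh n x ∧ 0 < DD n x ∧ 0 < OO n x := by
  obtain ⟨ρ, hρ, hexp⟩ := aa_expand n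
  have hn0 : (0:ℝ) < n := by exact_mod_cast hn
  obtain ⟨N, hN⟩ : ∃ N : ℝ, N = n := ⟨_, rfl⟩
  rw [← hN] at hn0 hexp
  set k : ℝ → ℝ := fun z => N - N^2*(N+1)/2 * z + N^2*(N+1)*(2*(N+1)*N-1)/6 * z^2 + z^3 * ρ z with hk
  set Y : ℝ → ℝ := fun z => (N+1) * k z^2 - N^2*(N+1)/2 + N^2*(N+1)*(2*(N+1)*N-1)/6 * z + z^2 * ρ z
    with hY
  set E : ℝ → ℝ := fun z => k z * (1 - z) - 2 * z * Y z with hE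
  set f : ℝ → ℝ := fun z => k z^2 * (1 + k z) * (1 + z * k z) * E z
    - (1 - z * k z^2) * Y z * (E z + k z * (1 - z)) with hf
  have hk0 : k 0 = N := by simp [hk]
  have hY0 : Y 0 = N^2*(N+1)/2 := by simp only [hY, hk0]; ring
  have hE0 : E 0 = N := by simp [hE, hk0]
  have hf0 : f 0 = 0 := by simp only [hf, hk0, hY0, hE0]; ring
  have hid : HasDerivAt (fun z : ℝ => z) 1 0 := hasDerivAt_id 0
  have hz2 : HasDerivAt (fun z : ℝ => z^2) 0 0 := by simpa using hasDerivAt_pow 2 (0:ℝ)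
  have hz3 : HasDerivAt (fun z : ℝ => z^3) 0 0 := by simpa using hasDerivAt_pow 3 (0:ℝ)
  have dρ := hρ.hasDerivAt
  have dk : HasDerivAt k (-(N^2*(N+1)/2)) 0 := by
    have := (((hid.const_mul (N^2*(N+1)/2)).const_sub N).add
      (hz2.const_mul (N^2*(N+1)*(2*(N+1)*N-1)/6))).add (hz3.mul dρ)
    refine this.congr_deriv ?_
    simp
  have dY : HasDerivAt Y (2 * (N+1) * N * (-(N^2*(N+1)/2)) + N^2*(N+1)*(2*(N+1)*N-1)/6) 0 := by
    have := (((((dk.pow 2).const_mul (N+1)).sub_const (N^2*(N+1)/2))).add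
      (hid.const_mul (N^2*(N+1)*(2*(N+1)*N-1)/6))).add (hz2.mul dρ)
    refine this.congr_deriv ?_
    simp [hk0]
    ring
  have dE : HasDerivAt E (-(N^2*(N+1)/2) - N - N^2*(N+1)) 0 := by
    have := (dk.mul (hid.const_sub 1)).sub ((hid.const_mul 2).mul dY)
    refine this.congr_deriv ?_
    simp [hk0, hY0]
    ring
  have df : HasDerivAt f (N^3*(N+1)*(2*N+1)*(N+2)/6) 0 := by
    have := ((((dk.pow 2).mul (dk.const_add 1)).mul ((hid.mul dk).const_add 1)).mul dE).sub
      ((((hid.mul (dk.pow 2)).const_sub 1).mul dY).mul (dE.add (dk.mul (hid.const_sub 1))))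
    refine this.congr_deriv ?_
    simp [hk0, hY0, hE0]
    ring
  have hc : 0 < N^3*(N+1)*(2*N+1)*(N+2)/6 := by positivity
  have ev1 : ∀ᶠ z in nhdsWithin (0:ℝ) (Set.Ioi 0), 0 < f z := by
    have hs := hasDerivAt_iff_tendsto_slope.1 df
    have hs2 := hs.mono_left (nhdsWithin_mono (0:ℝ) (fun y (hy : y ∈ Set.Ioi (0:ℝ)) => ne_of_gt hy))
    filter_upwards [hs2.eventually (lt_mem_nhds hc), self_mem_nhdsWithin] with z h1 h2
    have h2 : 0 < z := h2
    rw [slope_def_field, hf0, sub_zero, sub_zero] at h1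
    have := mul_pos h1 h2
    rwa [div_mul_cancel₀ _ h2.ne'] at this
  have ev2 : ∀ᶠ z in nhdsWithin (0:ℝ) (Set.Ioi 0), 0 < E z := by
    have := dE.continuousAt.tendsto
    rw [hE0] at this
    exact (this.eventually (lt_mem_nhds hn0)).filter_mono nhdsWithin_le_nhds
  have ev3 : ∀ᶠ z in nhdsWithin (0:ℝ) (Set.Ioi 0), k z < N + 1 := by
    have := dk.continuousAt.tendsto
    rw [hk0] at this
    exact (this.eventually (gt_mem_nhds (by linarith))).filter_mono nhdsWithin_le_nhds
  have ev4 : ∀ᶠ x in nhdsWithin (0:ℝ) (Set.Ioi 0), x < 1 / (N + 1) :=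
    (gt_mem_nhds (by positivity)).filter_mono nhdsWithin_le_nhds
  filter_upwards [sq_tendsto.eventually ev1, sq_tendsto.eventually ev2, sq_tendsto.eventually ev3,
    ev4, self_mem_nhdsWithin] with x h1 h2 h3 h4 h5
  have hx : 0 < x := h5
  have hh1 : hh n x = x * k (x^2) := by
    have e := hexp (x^2) (by positivity)
    change aa n (x^2) = x^2 * k (x^2) at e
    unfold hh
    rw [e]
    field_simp
  have hYk : x^2 * Y (x^2) = (N+1) * x^2 * k (x^2)^2 + k (x^2) - N := by
    simp only [hY, hk]; ring
  have hEe : E (x^2) = k (x^2) * (1 - x^2) - 2 * (x^2 * Y (x^2)) := by simp only [hE]; ring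
  have hD : DD n x = x * E (x^2) := by
    unfold DD
    rw [hh1, ← hN, hEe, hYk]; ring
  refine ⟨?_, ?_, ?_⟩
  · rw [hh1]
    have : x * k (x^2) < x * (N + 1) := mul_lt_mul_of_pos_left h3 hx
    rw [lt_div_iff₀ (by linarith)] at h4
    linarith
  · rw [hD]; positivity
  · have : OO n x = 2 * x^4 * f (x^2) := by
      unfold OO
      rw [hh1, hD]
      simp only [hf]
      generalize hkk : k (x^2) = κ at *
      generalize hyy : Y (x^2) = y at *
      rw [hEe]
      ring
    rw [this]; positivity

lemma hh_lt_one (n : ℕ) (hn : 1 ≤ n) : ∀ x ∈ Set.Ioo (0:ℝ) 1, 0 < 1 - hh n x := by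
  apply barrier (fun x => 1 - hh n x) (fun x => -(DD n x / (x * (1 - x^2))))
  · intro x hx
    exact (hh_deriv n hx.1 hx.2).const_sub 1
  · intro x hx h
    obtain ⟨h0, h1⟩ := hx
    have hh1 : hh n x = 1 := by linarith
    have hD : DD n x = -(2 * x + (1 + x^2)) := by unfold DD; rw [hh1]; ring
    have hz1 : 0 < 1 - x^2 := by nlinarith
    rw [hD, neg_div, neg_neg]
    positivity
  · exact (init n hn).mono fun x h => h.1

lemma DD_pos (n : ℕ) (hn : 1 ≤ n) : ∀ x ∈ Set.Ioo (0:ℝ) 1, 0 < DD n x := by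
  apply barrier (DD n) _ (fun x hx => DD_deriv n hx.1 hx.2)
  · intro x hx h
    obtain ⟨h0, h1⟩ := hx
    have hp := hh_pos n hn h0
    have hz1 : 0 < 1 - x^2 := by nlinarith
    rw [h]
    have h' := h
    unfold DD at h'
    have : 2*(n - (n+1) * hh n x ^ 2) = hh n x * (1 + x^2) / x := by
      field_simp; linarith
    rw [this]
    have : hh n x * (1 + x ^ 2) / x - 4 * (↑n + 1) * x * hh n x * (0 / (x * (1 - x ^ 2))) -
        0 / (x * (1 - x ^ 2)) * (1 + x ^ 2) - 2 * x * hh n x = hh n x * (1 - x^2) / x := by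
      simp; field_simp; ring
    rw [this]
    positivity
  · exact (init n hn).mono fun x h => h.2.1

lemma OO_alg (x h D m D' h' Om' : ℝ) (hx : 0 < x) (hx1 : x < 1) (hh0 : 0 < h) (hh1 : h < 1)
    (hD0 : 0 < D) (hD : D = 2*x*((m - 1) - m * h^2) - h * (1 + x^2))
    (hh' : h' = D / (x * (1 - x^2)))
    (hD' : D' = 2*((m-1) - m * h^2) - 4 * m * x * h * h' - h' * (1 + x^2) - 2 * x * h)
    (hO : 2 * h^2 * (x + h) * (1 + x * h) * D + (1 - h^2) * (D^2 - h^2 * (1 - x^2)^2) = 0)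
    (hOm : Om' = (2 * h^2 * (x + h) * (1 + x * h) + (1 - h^2) * (2 * D)) * D'
      + (4 * h * (x + h) * (1 + x * h) * D
          + 2 * h^2 * (1 + x * h) * D
          + 2 * h^2 * (x + h) * x * D
          - 2 * h * (D^2 - h^2 * (1 - x^2)^2)
          - (1 - h^2) * (2 * h * (1 - x^2)^2)) * h'
      + (2 * h^2 * (1 + x * h) * D
          + 2 * h^2 * (x + h) * h * D
          + (1 - h^2) * (h^2 * (4 * x * (1 - x^2))))) : 0 < Om' := by
  have hw : 0 < 1 - x^2 := by nlinarith
  have hv : 0 < 1 - h^2 := by nlinarith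
  have hT : 0 < h * (1 - x)^2 / (2 * x) := by
    have : 0 < 1 - x := by linarith
    positivity
  have hg : 0 < D / (2 * x) := by positivity
  have key := key_alg h (h * (1 - x)^2 / (2 * x)) (D / (2 * x)) hh0 hh1 hT hg (by
    field_simp
    linear_combination hO)
  have e1 : x * (1 - x^2) * h' = D := by rw [hh']; field_simp
  have e2 : x * (1 - x^2) * (1 - h^2) * D' = (1-x^2)*(1-h^2)*(D+h*(1+x^2))
      -2*h*D*(D+h*(1+x^2)+2*x)-(1-h^2)*(1+x^2)*D-2*x^2*h*(1-x^2)*(1-h^2) := by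
    have e3 : 2 * x * m * (1 - h^2) = D + h*(1+x^2) + 2*x := by rw [hD]; ring
    have e4 : 2*x*((m-1) - m * h^2) = D + h*(1+x^2) := by linarith
    rw [hD']
    linear_combination (1-x^2)*(1-h^2) * e4 - 2*h*(x * (1 - x^2) * h') * e3
      - (2*h*(D + h*(1+x^2) + 2*x) + (1-h^2)*(1+x^2)) * e1
  obtain ⟨K, hK⟩ : ∃ K, K = D / (2 * x) * ((1 + h) ^ 2 * (1 - 6 * h + h ^ 2) - 4 * (1 + h ^ 2) * (h * (1 - x) ^ 2 / (2 * x))) +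
      (1 - h ^ 2) * (4 * (h * (1 - x) ^ 2 / (2 * x)) ^ 2 + (8 * h - 1 + h ^ 2) * (h * (1 - x) ^ 2 / (2 * x)) -
        h * (1 - h ^ 2) * (1 + h)) := ⟨_, rfl⟩
  rw [← hK] at key
  have hK2 : x^2 * K = (D * ((1 + h) ^ 2 * (1 - 6 * h + h ^ 2) * x - 2 * (1 + h ^ 2) * (h * (1 - x) ^ 2)))/2 +
      (1 - h ^ 2) * ((h * (1 - x) ^ 2) ^ 2 + (8 * h - 1 + h ^ 2) * (h * (1 - x) ^ 2) * x / 2 -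
        h * (1 - h ^ 2) * (1 + h) * x^2) := by
    rw [hK]; field_simp; ring
  have main : x * (1 - x^2) * (1 - h^2) * Om' = -(4 * h * D * (x^2 * K)) := by
    rw [hOm, hK2]
    linear_combination (2 * h^2 * (x + h) * (1 + x * h) + (1 - h^2) * (2 * D)) * e2
      + (4 * h * (x + h) * (1 + x * h) * D
          + 2 * h^2 * (1 + x * h) * D
          + 2 * h^2 * (x + h) * x * D
          - 2 * h * (D^2 - h^2 * (1 - x^2)^2)
          - (1 - h^2) * (2 * h * (1 - x^2)^2)) * (1 - h^2) * e1
      + (-6*h*D - 4*x^2 - 2*x*h - 2*h^2 + 2*x^2*h^2 - 2*x*h^3) * hO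
  have hpos : 0 < x * (1 - x^2) * (1 - h^2) * Om' := by
    rw [main]
    have : 0 < 4 * h * D * (x^2 * (-K)) := by
      have : 0 < -K := by linarith
      positivity
    linarith
  exact (pos_iff_pos_of_mul_pos hpos).1 (by positivity)

lemma OO_pos (n : ℕ) (hn : 1 ≤ n) : ∀ x ∈ Set.Ioo (0:ℝ) 1, 0 < OO n x := by
  apply barrier (OO n) _ (fun x hx => OO_deriv n (hh_deriv n hx.1 hx.2) (DD_deriv n hx.1 hx.2))
  · intro x hx h
    have h1 := hh_lt_one n hn x hx
    refine OO_alg x (hh n x) (DD n x) (n+1) _ _ _ hx.1 hx.2 (hh_pos n hn hx.1) (by linarith)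
      (DD_pos n hn x hx) ?_ rfl ?_ h rfl
    · unfold DD; ring
    · ring
  · exact (init n hn).mono fun x h => h.2.2
noncomputable def SS (n : ℕ) (z : ℝ) : ℝ := n * z - z * aa n z - (n + 1) * aa n z ^ 2
noncomputable def TT (n : ℕ) (z : ℝ) : ℝ := aa n z * (1 - z) - SS n z
noncomputable def GG (n : ℕ) (z : ℝ) : ℝ :=
  z * TT n z * (1 + aa n z)^2 / (SS n z * (z + aa n z)^2)
noncomputable def FF (n : ℕ) (z : ℝ) : ℝ :=
  aa n z^2 * (1 + aa n z) * (z + aa n z) * (SS n z - TT n z)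
    - 2 * (z - aa n z^2) * SS n z * TT n z

lemma SS_FF_pos (n : ℕ) (hn : 1 ≤ n) {z : ℝ} (hz : 0 < z) (hz1 : z < 1) :
    0 < SS n z ∧ 0 < FF n z := by
  obtain ⟨x, hx⟩ : ∃ x, x = Real.sqrt z := ⟨_, rfl⟩
  have hx0 : 0 < x := by rw [hx]; exact Real.sqrt_pos.2 hz
  have hxz : z = x^2 := by rw [hx, Real.sq_sqrt hz.le]
  have hx1 : x < 1 := by nlinarith
  have ha : aa n z = x * hh n x := by
    rw [hxz]; unfold hh; field_simp
  have hp := hh_pos n hn hx0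
  have hD := DD_pos n hn x ⟨hx0, hx1⟩
  have hO := OO_pos n hn x ⟨hx0, hx1⟩
  have hS : SS n z = x / 2 * (DD n x + hh n x * (1 - x^2)) := by
    unfold SS DD; rw [ha, hxz]; ring
  have hT : TT n z = x / 2 * (hh n x * (1 - x^2) - DD n x) := by
    unfold TT; rw [hS, ha, hxz]; ring
  have hw : 0 < 1 - x^2 := by rw [← hxz]; linarith
  constructor
  · rw [hS]; positivity
  · have : FF n z = x^4 / 2 * OO n x := by
      unfold FF OO; rw [hS, hT, ha, hxz]; ring
    rw [this]; positivity

lemma GG_deriv (n : ℕ) (hn : 1 ≤ n) {z : ℝ} (hz : 0 < z) (hz1 : z < 1) :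
    ∃ d, 0 < d ∧ HasDerivAt (GG n) d z := by
  obtain ⟨hS, hF⟩ := SS_FF_pos n hn hz hz1
  have ha := aa_pos n hn hz
  have hn0 : (0:ℝ) < n := by exact_mod_cast hn
  have hw : 0 < 1 - z := by linarith
  refine ⟨(n + 1) * FF n z * (1 + aa n z) / (SS n z^2 * (z + aa n z)^3), by positivity, ?_⟩
  have d0 := aa_deriv n hz hz1
  change HasDerivAt (aa n) (SS n z / (z * (1 - z))) z at d0
  obtain ⟨R, hR⟩ : ∃ R, R = SS n z / (z * (1 - z)) := ⟨_, rfl⟩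
  have hid : HasDerivAt (fun z : ℝ => z) 1 z := hasDerivAt_id z
  rw [← hR] at d0
  have dS : HasDerivAt (SS n) (n - (aa n z + z * R) - (n+1) * (2 * aa n z * R)) z := by
    have := ((hid.const_mul (n:ℝ)).sub (hid.mul d0)).sub ((d0.pow 2).const_mul ((n:ℝ)+1))
    refine this.congr_deriv ?_
    simp
  have dT : HasDerivAt (TT n) (R * (1 - z) - aa n z
      - (n - (aa n z + z * R) - (n+1) * (2 * aa n z * R))) z := by
    have := (d0.mul (hid.const_sub 1)).sub dS
    refine this.congr_deriv ?_
    ring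
  have hne : SS n z * (z + aa n z)^2 ≠ 0 := by positivity
  have dG := ((hid.mul dT).mul ((d0.const_add 1).pow 2)).div (dS.mul ((hid.add d0).pow 2)) hne
  refine dG.congr_deriv ?_
  have hFd : FF n z = aa n z^2 * (1 + aa n z) * (z + aa n z) * (SS n z - TT n z)
    - 2 * (z - aa n z^2) * SS n z * TT n z := rfl
  have hTd : TT n z = aa n z * (1 - z) - SS n z := rfl
  have hSd : SS n z = n * z - z * aa n z - (n + 1) * aa n z ^ 2 := rfl
  have hc : z + aa n z ≠ 0 := by positivity
  have hS0 := hS.ne'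
  have hz0 := hz.ne'
  have hw0 := hw.ne'
  simp only [Pi.mul_apply, Pi.add_apply, Pi.pow_apply, hFd, hTd]
  generalize aa n z = a at *
  generalize SS n z = s at *
  generalize (n:ℝ) = N at *
  rw [hR]
  clear hR dG dT dS d0 hF hFd hTd hne
  field_simp
  subst hSd
  ring

theorem statement19 (n : ℕ) (hn : 1 ≤ n) (P P' P'' : ℝ → ℝ)
    (hP : ∀ q ∈ Set.Ioo (0 : ℝ) ((n : ℝ) / (2 * n + 1)), HasDerivAt P (P' q) q)
    (hP' : ∀ q ∈ Set.Ioo (0 : ℝ) ((n : ℝ) / (2 * n + 1)), HasDerivAt P' (P'' q) q)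
    (hP'' : ContinuousOn P'' (Set.Ioo (0 : ℝ) ((n : ℝ) / (2 * n + 1))))
    (hrange : ∀ q ∈ Set.Ioo (0 : ℝ) ((n : ℝ) / (2 * n + 1)), q < P q ∧ P q < 1 - q)
    (hnull : ∀ q ∈ Set.Ioo (0 : ℝ) ((n : ℝ) / (2 * n + 1)), J n q (P q) = 0) :
    ∀ q ∈ Set.Ioo (0 : ℝ) ((n : ℝ) / (2 * n + 1)), 0 < P'' q := by
  set I := Set.Ioo (0 : ℝ) ((n : ℝ) / (2 * n + 1)) with hI
  set Z : ℝ → ℝ := fun q => P q * q / ((1 - P q) * (1 - q)) with hZ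
  have basic : ∀ q ∈ I, 0 < q ∧ 0 < 1 - q ∧ 0 < P q ∧ 0 < 1 - P q ∧ 0 < Z q ∧ Z q < 1 ∧
      aa n (Z q) = q / (1 - q) := by
    intro q hq
    obtain ⟨h1, h2⟩ := hrange q hq
    have hq0 : 0 < q := hq.1
    have hp0 : 0 < P q := by linarith
    have hp1 : 0 < 1 - P q := by linarith
    have hq1 : 0 < 1 - q := by linarith
    have hz0 : 0 < Z q := by simp only [hZ]; positivity
    refine ⟨hq0, hq1, hp0, hp1, hz0, ?_, ?_⟩
    · simp only [hZ]
      rw [div_lt_one (by positivity)]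
      nlinarith
    · have h3 := hnull q hq
      unfold J at h3
      change q / (1 - q) * phi n (Z q) - psi n (Z q) = 0 at h3
      unfold aa
      rw [div_eq_iff (phi_pos n hz0.le).ne']
      linarith
  have hopen : IsOpen I := isOpen_Ioo
  have hZd : ∀ q ∈ I, HasDerivAt Z ((1 + aa n (Z q))^2 * (Z q * (1 - Z q)) / SS n (Z q)) q := by
    intro q hq
    obtain ⟨hq0, hq1, hp0, hp1, hz0, hz1, haz⟩ := basic q hq
    have hid : HasDerivAt (fun q : ℝ => q) 1 q := hasDerivAt_id q
    have hne : (1 - P q) * (1 - q) ≠ 0 := by positivity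
    have h1 := ((hP q hq).mul hid).div (((hP q hq).const_sub 1).mul (hid.const_sub 1)) hne
    obtain ⟨dz, hdz⟩ : ∃ dz, HasDerivAt Z dz q := ⟨_, h1⟩
    have h2 := (aa_deriv n hz0 hz1).comp q hdz
    have h3 : HasDerivAt (fun q : ℝ => q / (1 - q)) (1 / (1 - q)^2) q := by
      have := hid.div (hid.const_sub 1) hq1.ne'
      refine this.congr_deriv ?_
      ring
    have h4 : (aa n ∘ Z) =ᶠ[nhds q] fun q => q / (1 - q) := by
      filter_upwards [hopen.mem_nhds hq] with y hy using (basic y hy).2.2.2.2.2.2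
    have h5 := (h3.congr_of_eventuallyEq h4).unique h2
    change _ = SS n (Z q) / (Z q * (1 - Z q)) * dz at h5
    obtain ⟨hS, _⟩ := SS_FF_pos n hn hz0 hz1
    have h6 : 0 < 1 - Z q := by linarith
    refine hdz.congr_deriv ?_
    have h7 : 1 / (1 - q)^2 = (1 + aa n (Z q))^2 := by rw [haz]; field_simp; ring
    rw [h7] at h5
    rw [h5]
    field_simp
  have hPG : ∀ q ∈ I, P' q = GG n (Z q) := by
    intro q hq
    obtain ⟨hq0, hq1, hp0, hp1, hz0, hz1, haz⟩ := basic q hq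
    have hid : HasDerivAt (fun q : ℝ => q) 1 q := hasDerivAt_id q
    have h3 : HasDerivAt (fun q : ℝ => q / (1 - q)) (1 / (1 - q)^2) q := by
      have := hid.div (hid.const_sub 1) hq1.ne'
      refine this.congr_deriv ?_
      ring
    have h7 : 1 / (1 - q)^2 = (1 + aa n (Z q))^2 := by rw [haz]; field_simp; ring
    obtain ⟨hS, _⟩ := SS_FF_pos n hn hz0 hz1
    have ha := aa_pos n hn hz0
    rw [h7] at h3
    have h8 := (hZd q hq).div ((hZd q hq).add h3) (by
      show Z q + q / (1 - q) ≠ 0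
      positivity)
    have h9 : P =ᶠ[nhds q] (fun q => Z q / (Z q + q / (1 - q))) := by
      filter_upwards [hopen.mem_nhds hq] with y hy
      obtain ⟨hq0, hq1, hp0, hp1, hz0, hz1, haz⟩ := basic y hy
      simp only [hZ]
      have : P y * y / ((1 - P y) * (1 - y)) + y / (1 - y) = y / ((1 - P y) * (1 - y)) := by
        field_simp; ring
      rw [this]
      field_simp
    have h10 := (hP q hq).unique (HasDerivAt.congr_of_eventuallyEq h8 h9)
    rw [h10]
    simp only [Pi.add_apply]
    rw [← haz]
    unfold GG TT
    generalize aa n (Z q) = a at *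
    generalize Z q = z at *
    field_simp
    ring
  intro q hq
  obtain ⟨hq0, hq1, hp0, hp1, hz0, hz1, haz⟩ := basic q hq
  obtain ⟨d, hd, hG⟩ := GG_deriv n hn hz0 hz1
  obtain ⟨hS, _⟩ := SS_FF_pos n hn hz0 hz1
  have ha := aa_pos n hn hz0
  have h1 := hG.comp q (hZd q hq)
  have h2 : P' =ᶠ[nhds q] GG n ∘ Z := by
    filter_upwards [hopen.mem_nhds hq] with y hy using hPG y hy
  have h3 := (hP' q hq).unique (h1.congr_of_eventuallyEq h2)
  rw [h3]
  have h6 : 0 < 1 - Z q := by linarith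
  positivity
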